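/- arXiv:2010.14858 — 4 statements merged into one kernel-verified Lean document; each statement's English description precedes it below -/
import Mathlib

section
/- For every real numbers λ and z with 0 ≤ λ ≤ z, it holds that z E₁(z) − e^{λ−z} λ E₁(λ) ≥ 0, where 0·E₁(0) is interpreted as 0. -/
/-- The exponential integral function `E₁(z) = ∫₁^∞ e^{-zt}/t dt`. -/
noncomputable def E1 (z : ℝ) : ℝ := ∫ t in Set.Ioi (1 : ℝ), Real.exp (-z * t) / t

open MeasureTheory Set in
/-- The substitution `t = 1 + u / z` in the integral defining `E₁`. -/
theorem mul_E1_eq_exp_neg_mul_integral {z : ℝ} (hz : 0 < z) :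
    z * E1 z = Real.exp (-z) * ∫ u in Ioi (0 : ℝ), Real.exp (-u) * (z / (u + z)) := by
  have scale : z * E1 z = ∫ x in Ioi z, Real.exp (-x) * (z / x) := by
    have h := integral_comp_mul_left_Ioi' (fun x : ℝ => Real.exp (-x) * (z / x)) 1 hz
    rw [mul_one, smul_eq_mul] at h
    rw [← h, E1]
    congr 2
    ext t
    rw [neg_mul, div_mul_cancel_left₀ hz.ne', div_eq_mul_inv]
  have shift := (measurePreserving_add_right volume z).setIntegral_preimage_emb
    (measurableEmbedding_addRight z) (fun x : ℝ => Real.exp (-x) * (z / x)) (Ioi z)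
  rw [preimage_add_const_Ioi, sub_self] at shift
  rw [scale, ← shift, ← integral_const_mul]
  congr 1
  ext u
  rw [neg_add, Real.exp_add]
  ring

open MeasureTheory Set in
theorem integrableOn_exp_neg_mul_div_add {z : ℝ} (hz : 0 < z) :
    IntegrableOn (fun u : ℝ => Real.exp (-u) * (z / (u + z))) (Ioi 0) := by
  refine (integrableOn_exp_neg_Ioi 0).mono' (by fun_prop) ?_
  filter_upwards [ae_restrict_mem measurableSet_Ioi] with u hu
  have hu : 0 < u := hu
  rw [Real.norm_of_nonneg (by positivity)]
  refine mul_le_of_le_one_right (Real.exp_pos _).le ?_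
  rw [div_le_one (by positivity)]
  linarith

/-- For all `0 ≤ λ ≤ z`, it holds that `z E₁(z) - e^{λ-z} λ E₁(λ) ≥ 0`
(with the convention `0·E₁(0) = 0`, which holds definitionally here since the defining
integral of `E₁` at `0` is divergent and hence evaluates to `0`). -/
theorem zE1_sub_exp_lamE1_nonneg (lam z : ℝ) (hlam : 0 ≤ lam) (hz : lam ≤ z) :
    0 ≤ z * E1 z - Real.exp (lam - z) * (lam * E1 lam) := by
  rcases hlam.eq_or_lt with rfl | hpos
  · rw [zero_mul, mul_zero, sub_zero]
    refine mul_nonneg hz (MeasureTheory.setIntegral_nonneg measurableSet_Ioi fun t ht => ?_)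
    have ht : 0 < t := zero_lt_one.trans ht
    positivity
  · have hzpos : 0 < z := hpos.trans_le hz
    rw [mul_E1_eq_exp_neg_mul_integral hpos, mul_E1_eq_exp_neg_mul_integral hzpos, ← mul_assoc,
      ← Real.exp_add, show lam - z + -lam = -z by ring, ← mul_sub]
    refine mul_nonneg (Real.exp_pos _).le (sub_nonneg.2 ?_)
    refine MeasureTheory.setIntegral_mono_on (integrableOn_exp_neg_mul_div_add hpos)
      (integrableOn_exp_neg_mul_div_add hzpos) measurableSet_Ioi fun u hu => ?_
    have hu : 0 < u := hu
    refine mul_le_mul_of_nonneg_left ?_ (Real.exp_pos _).le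
    rw [div_le_div_iff₀ (by positivity) (by positivity)]
    nlinarith
end

section
/- For every z > 0, it holds that (1 + z) e^z E₁(z) ≥ 1; equivalently, the derivative of f(z) = z e^z E₁(z), which equals (1+z) e^z E₁(z) − 1, is nonnegative on (0, ∞). -/
open MeasureTheory Set Filter Topology in
/-- The mean of `t` against `e^{-zt}` on `(1,∞)` is `(1+z)/z`; this is the integral of `e^{-zt}` times
the (rescaled) tangent line of `1/t` at that point. -/
lemma integral_exp_mul_tangent {z : ℝ} (hz : 0 < z) :
    IntegrableOn (fun t ↦ Real.exp (-z * t) * (2 * z * (1 + z) - z ^ 2 * t)) (Ioi 1) ∧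
      ∫ t in Ioi (1 : ℝ), Real.exp (-z * t) * (2 * z * (1 + z) - z ^ 2 * t) =
        (1 + z) * Real.exp (-z) := by
  have hexp : IntegrableOn (fun t : ℝ ↦ Real.exp (-z * t)) (Ioi 1) :=
    exp_neg_integrableOn_Ioi 1 hz
  have hmul : IntegrableOn (fun t : ℝ ↦ t * Real.exp (-z * t)) (Ioi 1) := by
    have h := integrableOn_rpow_mul_exp_neg_mul_rpow (p := 1) (s := 1) (by norm_num) one_pos hz
    simp only [Real.rpow_one] at h
    exact h.mono_set (Ioi_subset_Ioi zero_le_one)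
  have hint : IntegrableOn
      (fun t ↦ Real.exp (-z * t) * (2 * z * (1 + z) - z ^ 2 * t)) (Ioi 1) := by
    refine ((hexp.const_mul (2 * z * (1 + z))).sub (hmul.const_mul (z ^ 2))).congr
      (Eventually.of_forall fun t ↦ ?_)
    simp only [Pi.sub_apply]
    ring
  have hderiv (t : ℝ) : HasDerivAt (fun t ↦ Real.exp (-z * t) * (z * t - (1 + 2 * z)))
      (Real.exp (-z * t) * (2 * z * (1 + z) - z ^ 2 * t)) t := by
    refine ((((hasDerivAt_id' t).const_mul (-z)).exp).mul
      (((hasDerivAt_id' t).const_mul z).sub_const (1 + 2 * z))).congr_deriv ?_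
    ring
  have hlim : Tendsto (fun t ↦ Real.exp (-z * t) * (z * t - (1 + 2 * z))) atTop (𝓝 0) := by
    have hzt : Tendsto (fun t : ℝ ↦ z * t) atTop atTop := tendsto_id.const_mul_atTop hz
    have h₁ := (Real.tendsto_pow_mul_exp_neg_atTop_nhds_zero 1).comp hzt
    have h₀ := (Real.tendsto_exp_neg_atTop_nhds_zero.comp hzt).const_mul (1 + 2 * z)
    convert h₁.sub h₀ using 1
    · ext t
      simp only [Function.comp_apply, neg_mul]
      ring
    · simp
  refine ⟨hint, ?_⟩
  rw [integral_Ioi_of_hasDerivAt_of_tendsto' (fun t _ ↦ hderiv t) hint hlim]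
  ring_nf

/-- For every `z > 0`, `(1+z) e^z E₁(z) ≥ 1`; equivalently, the derivative
`(1+z) e^z E₁(z) - 1` of `f(z) = z e^z E₁(z)` is nonnegative on `(0,∞)`. -/
theorem one_le_one_add_mul_exp_E1 (z : ℝ) (hz : 0 < z) :
    1 ≤ (1 + z) * Real.exp z * E1 z := by
  obtain ⟨hint, hval⟩ := integral_exp_mul_tangent hz
  have hE : MeasureTheory.IntegrableOn (fun t : ℝ ↦ Real.exp (-z * t) / t) (Set.Ioi 1) := by
    refine (exp_neg_integrableOn_Ioi 1 hz).mono' (Measurable.aestronglyMeasurable (by fun_prop)) ?_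
    filter_upwards [MeasureTheory.ae_restrict_mem measurableSet_Ioi] with t ht
    have ht : 1 < t := ht
    rw [Real.norm_of_nonneg (by positivity)]
    exact div_le_self (Real.exp_pos _).le ht.le
  have hle : (1 + z) * Real.exp (-z) ≤ (1 + z) ^ 2 * E1 z := by
    rw [← hval, E1, ← MeasureTheory.integral_const_mul]
    refine MeasureTheory.setIntegral_mono_on hint (hE.const_mul _) measurableSet_Ioi fun t ht ↦ ?_
    have ht : 0 < t := zero_lt_one.trans ht
    rw [mul_div_assoc', le_div_iff₀ ht]
    nlinarith [mul_nonneg (Real.exp_pos (-z * t)).le (sq_nonneg (1 + z - z * t))]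
  have hE1 : Real.exp (-z) ≤ (1 + z) * E1 z := by
    refine le_of_mul_le_mul_left ?_ (by linarith : 0 < 1 + z)
    linarith
  calc 1 = Real.exp z * Real.exp (-z) := by rw [← Real.exp_add]; simp
    _ ≤ Real.exp z * ((1 + z) * E1 z) := by gcongr
    _ = (1 + z) * Real.exp z * E1 z := by ring
end

section
/- For every z > 0, it holds that e^z E₁(z) > (1/2) ln(1 + 2/z). -/
open MeasureTheory Set Filter Topology

theorem Real.log_lt_half_sub_inv {u : ℝ} (hu : 1 < u) : Real.log u < (u - u⁻¹) / 2 := by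
  rw [← Real.sinh_log (by linarith)]
  exact Real.self_lt_sinh_iff.2 (Real.log_pos hu)

theorem log_one_add_two_div_lt {x : ℝ} (hx : 0 < x) :
    x / 2 * Real.log (1 + 2 / x) + 1 / (x + 2) < 1 := by
  have h := Real.log_lt_half_sub_inv (u := 1 + 2 / x) (by linarith [div_pos two_pos hx])
  have h2 : x / 2 * ((1 + 2 / x - (1 + 2 / x)⁻¹) / 2) + 1 / (x + 2) = 1 := by
    field_simp
    ring
  have h3 := mul_lt_mul_of_pos_left h (half_pos hx)
  linarith

theorem hasDerivAt_exp_mul_log {z t : ℝ} (hz : 0 < z) (ht : 0 < t) :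
    HasDerivAt (fun t ↦ -(1 / 2) * (Real.exp (-z * t) * Real.log (1 + 2 / (z * t))))
      (Real.exp (-z * t) / t * (z * t / 2 * Real.log (1 + 2 / (z * t)) + 1 / (z * t + 2))) t := by
  have hzt : 0 < z * t := mul_pos hz ht
  have hlin (c : ℝ) : HasDerivAt (fun t ↦ c * t) c t := by
    simpa using (hasDerivAt_id t).const_mul c
  have hlog := (((hasDerivAt_const t (2 : ℝ)).fun_div (hlin z) hzt.ne').const_add 1).log
    (by positivity)
  refine (((hlin (-z)).exp.mul hlog).const_mul (-(1 / 2))).congr_deriv ?_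
  field_simp
  ring

theorem tendsto_exp_mul_log {z : ℝ} (hz : 0 < z) :
    Tendsto (fun t ↦ -(1 / 2) * (Real.exp (-z * t) * Real.log (1 + 2 / (z * t))))
      atTop (𝓝 0) := by
  have hmul : Tendsto (fun t : ℝ ↦ z * t) atTop atTop := tendsto_id.const_mul_atTop hz
  have hexp : Tendsto (fun t : ℝ ↦ Real.exp (-z * t)) atTop (𝓝 0) := by
    simpa [Function.comp_def] using Real.tendsto_exp_neg_atTop_nhds_zero.comp hmul
  have hlog : Tendsto (fun t : ℝ ↦ Real.log (1 + 2 / (z * t))) atTop (𝓝 (Real.log (1 + 0))) :=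
    ((hmul.const_div_atTop 2).const_add 1).log (by norm_num)
  simpa using (hexp.mul hlog).const_mul (-(1 / 2) : ℝ)

theorem integrableOn_exp_neg_mul_div {z : ℝ} (hz : 0 < z) :
    IntegrableOn (fun t ↦ Real.exp (-z * t) / t) (Ioi 1) := by
  refine Integrable.mono' (exp_neg_integrableOn_Ioi 1 hz)
    (by fun_prop : Measurable fun t : ℝ ↦ Real.exp (-z * t) / t).aestronglyMeasurable ?_
  filter_upwards [ae_restrict_mem measurableSet_Ioi] with t ht
  have ht : (1 : ℝ) < t := ht
  rw [Real.norm_of_nonneg (by positivity)]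
  exact div_le_self (Real.exp_pos _).le ht.le

/-- For every `z > 0`, `e^z E₁(z) > (1/2) ln(1 + 2/z)`. -/
theorem exp_mul_E1_gt (z : ℝ) (hz : 0 < z) :
    (1 / 2) * Real.log (1 + 2 / z) < Real.exp z * E1 z := by
  set g : ℝ → ℝ := fun t ↦
    Real.exp (-z * t) / t * (z * t / 2 * Real.log (1 + 2 / (z * t)) + 1 / (z * t + 2))
  have hderiv : ∀ t ∈ Ici (1 : ℝ), HasDerivAt
      (fun t ↦ -(1 / 2) * (Real.exp (-z * t) * Real.log (1 + 2 / (z * t)))) (g t) t :=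
    fun t ht ↦ hasDerivAt_exp_mul_log hz (one_pos.trans_le ht)
  have hnonneg : ∀ t ∈ Ioi (1 : ℝ), 0 ≤ g t := by
    intro t ht
    have ht : 0 < t := one_pos.trans ht
    have hlog : 0 ≤ Real.log (1 + 2 / (z * t)) :=
      Real.log_nonneg (le_add_of_nonneg_right (by positivity))
    positivity
  have hint := integrableOn_Ioi_deriv_of_nonneg' hderiv hnonneg (tendsto_exp_mul_log hz)
  have hval := integral_Ioi_of_hasDerivAt_of_nonneg' hderiv hnonneg (tendsto_exp_mul_log hz)
  have hlt : ∀ t ∈ Ioi (1 : ℝ), 0 < Real.exp (-z * t) / t - g t := by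
    intro t ht
    have ht : 0 < t := one_pos.trans ht
    exact sub_pos.2 (mul_lt_of_lt_one_right (by positivity)
      (log_one_add_two_div_lt (by positivity)))
  have hpos : 0 < ∫ t in Ioi (1 : ℝ), (Real.exp (-z * t) / t - g t) := by
    rw [setIntegral_pos_iff_support_of_nonneg_ae
      ((ae_restrict_mem measurableSet_Ioi).mono fun t ht ↦ (hlt t ht).le)
      ((integrableOn_exp_neg_mul_div hz).sub hint),
      inter_eq_right.2 fun t ht ↦ Function.mem_support.2 (hlt t ht).ne']
    simp
  rw [integral_sub (integrableOn_exp_neg_mul_div hz) hint, hval] at hpos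
  have hE : Real.exp (-z) * ((1 / 2) * Real.log (1 + 2 / z)) < E1 z := by
    simp only [mul_one] at hpos
    unfold E1
    linarith
  calc (1 / 2) * Real.log (1 + 2 / z)
      = Real.exp z * (Real.exp (-z) * ((1 / 2) * Real.log (1 + 2 / z))) := by
        rw [← mul_assoc, ← Real.exp_add, add_neg_cancel, Real.exp_zero, one_mul]
    _ < Real.exp z * E1 z := mul_lt_mul_of_pos_left hE (Real.exp_pos z)
end

section
/- For every λ > 0, setting δ_λ = exp(−λ e^λ E₁(λ)), it holds that δ_λ ≤ (1 − e^{−λ e^γ})^{λ e^λ}; this follows from the lower bound E₁(λ) ≥ −ln(1 − e^{−λ e^γ}). -/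
open MeasureTheory Set Filter Topology

/-- The integral `∫₀^∞ e^{-t} log t dt` converges absolutely. -/
lemma integrableOn_exp_neg_mul_log :
    IntegrableOn (fun t : ℝ => Real.exp (-t) * Real.log t) (Ioi 0) := by
  have h₂ := Real.GammaIntegral_convergent (s := 2) (by norm_num)
  have h₁ := Real.GammaIntegral_convergent (s := 1 / 2) (by norm_num)
  refine Integrable.mono' (h₂.add (h₁.const_mul 2)) ?_ ?_
  · exact (by fun_prop : Measurable fun t : ℝ => Real.exp (-t) * Real.log t).aestronglyMeasurable
  · filter_upwards [ae_restrict_mem measurableSet_Ioi] with t ht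
    have ht : 0 < t := ht
    have hlog : Real.log t ≤ t := Real.log_le_self ht.le
    have hinv := Real.log_le_rpow_div (inv_pos.2 ht).le (by norm_num : (0 : ℝ) < 1 / 2)
    rw [Real.log_inv, Real.inv_rpow ht.le, ← Real.rpow_neg ht.le] at hinv
    have hpos : 0 < t ^ (-(1 / 2) : ℝ) := Real.rpow_pos_of_pos ht _
    have habs : |Real.log t| ≤ t + 2 * t ^ (-(1 / 2) : ℝ) := by
      rw [abs_le]; constructor <;> linarith
    have e₂ : t ^ ((2 : ℝ) - 1) = t := by norm_num
    have e₁ : (1 / 2 - 1 : ℝ) = -(1 / 2) := by norm_num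
    simp only [Pi.add_apply, e₂, e₁, norm_mul, Real.norm_eq_abs, Real.abs_exp]
    nlinarith [Real.exp_pos (-t)]

/-- Euler's formula `∫₀^∞ e^{-t} log t dt = -γ`. -/
lemma integral_exp_neg_mul_log :
    ∫ t in Ioi (0 : ℝ), Real.exp (-t) * Real.log t = -Real.eulerMascheroniConstant := by
  have h := Complex.hasDerivAt_GammaIntegral (s := 1) (by simp)
  have hG : HasDerivAt Complex.GammaIntegral (-(Real.eulerMascheroniConstant : ℂ)) 1 := by
    refine Complex.hasDerivAt_Gamma_one.congr_of_eventuallyEq ?_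
    have : {s : ℂ | 0 < s.re} ∈ 𝓝 (1 : ℂ) :=
      (isOpen_lt continuous_const Complex.continuous_re).mem_nhds (by simp)
    filter_upwards [this] with s hs using (Complex.Gamma_eq_integral hs).symm
  have key := h.unique hG
  have e : ∫ t in Ioi (0 : ℝ), (t : ℂ) ^ ((1 : ℂ) - 1) * (Real.log t * Real.exp (-t)) =
      ∫ t in Ioi (0 : ℝ), ((Real.exp (-t) * Real.log t : ℝ) : ℂ) := by
    congr 1 with t
    push_cast
    simp [mul_comm]
  rw [e, integral_complex_ofReal] at key
  exact_mod_cast key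

/-- `e^{-t} log t` is integrable on every bounded interval. -/
lemma intervalIntegrable_exp_neg_mul_log (a b : ℝ) :
    IntervalIntegrable (fun t : ℝ => Real.exp (-t) * Real.log t) volume a b :=
  intervalIntegral.intervalIntegrable_log'.continuousOn_mul (by fun_prop)

/-- `e^{-t} log t → 0` as `t → ∞`. -/
lemma tendsto_exp_neg_mul_log_atTop :
    Tendsto (fun t : ℝ => Real.exp (-t) * Real.log t) atTop (𝓝 0) := by
  refine tendsto_of_tendsto_of_tendsto_of_le_of_le' tendsto_const_nhds
    (Real.tendsto_pow_mul_exp_neg_atTop_nhds_zero 1) ?_ ?_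
  · filter_upwards [eventually_ge_atTop 1] with t ht
    exact mul_nonneg (Real.exp_pos _).le (Real.log_nonneg ht)
  · filter_upwards [eventually_ge_atTop 1] with t ht
    nlinarith [Real.exp_pos (-t), Real.log_le_self (zero_le_one.trans ht)]

/-- Integrating by parts, `E₁(x) = -γ - ∫₀ˣ e^{-t} log t dt - e^{-x} log x`. -/
lemma E1_eq {x : ℝ} (hx : 0 < x) :
    E1 x = -Real.eulerMascheroniConstant - (∫ t in (0 : ℝ)..x, Real.exp (-t) * Real.log t)
      - Real.exp (-x) * Real.log x := by
  have hsub : E1 x = ∫ t in Ioi x, Real.exp (-t) / t := by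
    have h := integral_comp_mul_left_Ioi (fun t : ℝ => Real.exp (-t) / t) 1 hx
    rw [mul_one, smul_eq_mul, eq_inv_mul_iff_mul_eq₀ hx.ne', ← integral_const_mul] at h
    rw [← h, E1]
    congr 1 with t
    field_simp
  have hint := integrableOn_exp_neg_mul_log.mono_set (Ioi_subset_Ioi hx.le)
  have hdiv : IntegrableOn (fun t : ℝ => Real.exp (-t) / t) (Ioi x) := by
    refine Integrable.mono' ((integrableOn_exp_neg_Ioi x).div_const x) ?_ ?_
    · exact (by fun_prop : Measurable fun t : ℝ => Real.exp (-t) / t).aestronglyMeasurable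
    · filter_upwards [ae_restrict_mem measurableSet_Ioi] with t ht
      have ht : x < t := ht
      rw [norm_div, Real.norm_eq_abs, Real.norm_eq_abs, Real.abs_exp, abs_of_pos (hx.trans ht)]
      gcongr
  have hderiv : ∀ t : ℝ, 0 < t → HasDerivAt (fun t : ℝ => Real.exp (-t) * Real.log t)
      (Real.exp (-t) / t - Real.exp (-t) * Real.log t) t := fun t ht => by
    convert! (hasDerivAt_neg t).exp.mul (Real.hasDerivAt_log ht.ne') using 1
    ring
  have hparts := integral_Ioi_of_hasDerivAt_of_tendsto
    (hderiv x hx).continuousAt.continuousWithinAt (fun t ht => hderiv t (hx.trans ht))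
    (hdiv.sub hint) tendsto_exp_neg_mul_log_atTop
  rw [integral_sub hdiv hint, ← hsub] at hparts
  have hsplit := intervalIntegral.integral_interval_add_Ioi integrableOn_exp_neg_mul_log hint
  rw [integral_exp_neg_mul_log] at hsplit
  linarith

/-- The exponential integral has derivative `-e^{-x}/x`. -/
lemma hasDerivAt_E1 {x : ℝ} (hx : 0 < x) : HasDerivAt E1 (-(Real.exp (-x) / x)) x := by
  have hprim : HasDerivAt (fun u => ∫ t in (0 : ℝ)..u, Real.exp (-t) * Real.log t)
      (Real.exp (-x) * Real.log x) x := by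
    refine intervalIntegral.integral_hasDerivAt_right (intervalIntegrable_exp_neg_mul_log 0 x) ?_ ?_
    · exact (by fun_prop : Measurable fun t : ℝ => Real.exp (-t) * Real.log t)
        |>.stronglyMeasurable.stronglyMeasurableAtFilter
    · exact (by fun_prop : ContinuousAt (fun t : ℝ => Real.exp (-t)) x).mul
        (Real.continuousAt_log hx.ne')
  have h := ((hasDerivAt_const x (-Real.eulerMascheroniConstant)).sub hprim).sub
    ((hasDerivAt_neg x).exp.mul (Real.hasDerivAt_log hx.ne'))
  refine (h.congr_of_eventuallyEq ?_).congr_deriv (by ring)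
  filter_upwards [lt_mem_nhds hx] with y hy using E1_eq hy

/-- `E₁(x) → 0` as `x → ∞`. -/
lemma tendsto_E1_atTop : Tendsto E1 atTop (𝓝 0) := by
  have h := ((tendsto_const_nhds (x := -Real.eulerMascheroniConstant)).sub
    (intervalIntegral_tendsto_integral_Ioi 0 integrableOn_exp_neg_mul_log tendsto_id)).sub
    tendsto_exp_neg_mul_log_atTop
  rw [integral_exp_neg_mul_log, sub_self, sub_zero] at h
  refine h.congr' ?_
  filter_upwards [eventually_gt_atTop 0] with x hx using (E1_eq hx).symm

/-- `(1 - e^{-ax})/x → a` as `x → 0⁺`. -/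
lemma tendsto_one_sub_exp_neg_mul_div (a : ℝ) :
    Tendsto (fun x : ℝ => (1 - Real.exp (-(x * a))) / x) (𝓝[>] 0) (𝓝 a) := by
  have h : HasDerivAt (fun x : ℝ => 1 - Real.exp (-(x * a))) a 0 := by
    refine ((((hasDerivAt_id (0 : ℝ)).mul_const a).neg.exp).const_sub 1).congr_deriv ?_
    simp
  refine h.tendsto_slope_zero_right.congr fun x => ?_
  simp [div_eq_inv_mul]

/-- `E₁(x) + log x → -γ` as `x → 0⁺`. -/
lemma tendsto_E1_add_log :
    Tendsto (fun x => E1 x + Real.log x) (𝓝[>] 0) (𝓝 (-Real.eulerMascheroniConstant)) := by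
  have hprim : Tendsto (fun x => ∫ t in (0 : ℝ)..x, Real.exp (-t) * Real.log t)
      (𝓝[>] 0) (𝓝 0) := by
    have h := (intervalIntegral.continuous_primitive intervalIntegrable_exp_neg_mul_log 0).tendsto 0
    rw [intervalIntegral.integral_same] at h
    exact h.mono_left nhdsWithin_le_nhds
  have hlog : Tendsto (fun x : ℝ => x * Real.log x) (𝓝[>] 0) (𝓝 0) := by
    have h := Real.continuous_mul_log.tendsto 0
    rw [zero_mul] at h
    exact h.mono_left nhdsWithin_le_nhds
  have h := ((tendsto_const_nhds (x := -Real.eulerMascheroniConstant)).sub hprim).add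
    ((tendsto_one_sub_exp_neg_mul_div 1).mul hlog)
  rw [sub_zero, mul_zero, add_zero] at h
  refine h.congr' ?_
  filter_upwards [self_mem_nhdsWithin] with x hx
  have hx : 0 < x := hx
  rw [E1_eq hx]
  field_simp
  ring_nf

/-- Once `log (1 + x) + x - a x` is nonpositive at a positive point, it remains so. -/
lemma log_one_add_add_sub_nonpos_of_le {a c y : ℝ} (hc : 0 < c) (hcy : c ≤ y)
    (h : Real.log (1 + c) + c - a * c ≤ 0) : Real.log (1 + y) + y - a * y ≤ 0 := by
  have hy : 0 < y := hc.trans_le hcy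
  have hconc := strictConcaveOn_log_Ioi.concaveOn.2 (mem_Ioi.2 one_pos)
    (mem_Ioi.2 (by linarith : 0 < 1 + y)) (sub_nonneg.2 ((div_le_one hy).2 hcy))
    (div_pos hc hy).le (sub_add_cancel 1 (c / y))
  have e : (1 - c / y) * 1 + c / y * (1 + y) = 1 + c := by field_simp; ring
  simp only [smul_eq_mul, e, Real.log_one, mul_zero, zero_add] at hconc
  have : c * (Real.log (1 + y) + y - a * y) ≤ 0 := by
    have h' : c / y * Real.log (1 + y) * y ≤ Real.log (1 + c) * y := by gcongr
    rw [div_mul_eq_mul_div, div_mul_cancel₀ _ hy.ne'] at h'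
    nlinarith
  nlinarith

/-- Once `a x eˣ - e^{ax} + 1` is nonpositive at a positive point, it remains so. -/
lemma mul_exp_sub_exp_nonpos_of_le {a x y : ℝ} (ha : 0 < a) (hx : 0 < x) (hxy : x ≤ y)
    (h : a * x * Real.exp x - Real.exp (x * a) + 1 ≤ 0) :
    a * y * Real.exp y - Real.exp (y * a) + 1 ≤ 0 := by
  have hderiv : ∀ t : ℝ, HasDerivAt (fun t : ℝ => a * t * Real.exp t - Real.exp (t * a) + 1)
      (a * ((1 + t) * Real.exp t - Real.exp (t * a))) t := fun t => by
    refine ((((hasDerivAt_id t).const_mul a).mul (Real.hasDerivAt_exp t)).sub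
      ((hasDerivAt_id t).mul_const a).exp |>.add_const 1).congr_deriv ?_
    simp only [id]
    ring
  have hcont : Continuous fun t : ℝ => a * t * Real.exp t - Real.exp (t * a) + 1 := by fun_prop
  obtain ⟨c, ⟨hc, hcx⟩, hslope⟩ := exists_hasDerivAt_eq_slope _ _ hx hcont.continuousOn
    fun t _ => hderiv t
  -- the derivative has the sign of `log (1 + t) + t - a t`
  have hsign : ∀ t : ℝ, 0 < t → (a * ((1 + t) * Real.exp t - Real.exp (t * a)) ≤ 0 ↔
      Real.log (1 + t) + t - a * t ≤ 0) := fun t ht => by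
    have e : (1 + t) * Real.exp t = Real.exp (Real.log (1 + t) + t) := by
      rw [Real.exp_add, Real.exp_log (by linarith)]
    rw [← neg_nonneg, ← mul_neg, mul_nonneg_iff_of_pos_left ha, neg_nonneg, sub_nonpos, sub_nonpos,
      e, Real.exp_le_exp, mul_comm t a]
  have hc' : a * ((1 + c) * Real.exp c - Real.exp (c * a)) ≤ 0 := by
    rw [hslope]
    refine div_nonpos_of_nonpos_of_nonneg ?_ (by linarith)
    simpa using h
  rw [hsign c hc] at hc'
  have hanti : AntitoneOn (fun t : ℝ => a * t * Real.exp t - Real.exp (t * a) + 1) (Ici c) := by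
    refine antitoneOn_of_deriv_nonpos (convex_Ici c) hcont.continuousOn
      (fun t _ => (hderiv t).differentiableAt.differentiableWithinAt) fun t ht => ?_
    rw [interior_Ici] at ht
    rw [(hderiv t).deriv, hsign t (hc.trans ht)]
    exact log_one_add_add_sub_nonpos_of_le hc (le_of_lt ht) hc'
  exact (hanti hcx.le (hcx.le.trans hxy) hxy).trans h

/-- The lower bound `E₁(x) ≥ -log (1 - e^{-x e^γ})`. -/
lemma E1_add_log_nonneg {x : ℝ} (hx : 0 < x) :
    0 ≤ E1 x + Real.log (1 - Real.exp (-(x * Real.exp Real.eulerMascheroniConstant))) := by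
  set a := Real.exp Real.eulerMascheroniConstant with ha_def
  have ha : 0 < a := Real.exp_pos _
  have hpos : ∀ t : ℝ, 0 < t → 0 < 1 - Real.exp (-(t * a)) := fun t ht => by
    rw [sub_pos, Real.exp_lt_one_iff]
    nlinarith [mul_pos ht ha]
  set f : ℝ → ℝ := fun t => E1 t + Real.log (1 - Real.exp (-(t * a))) with hf
  have hderiv : ∀ t : ℝ, 0 < t → HasDerivAt f (Real.exp (-t) * Real.exp (-(t * a)) *
      (a * t * Real.exp t - Real.exp (t * a) + 1) / (t * (1 - Real.exp (-(t * a))))) t := by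
    intro t ht
    have hne := (hpos t ht).ne'
    refine ((hasDerivAt_E1 ht).add
      ((((hasDerivAt_id t).mul_const a).neg.exp.const_sub 1).log hne)).congr_deriv ?_
    have e₁ : Real.exp (-t) * Real.exp t = 1 := by rw [← Real.exp_add]; simp
    have e₂ : Real.exp (-(t * a)) * Real.exp (t * a) = 1 := by rw [← Real.exp_add]; simp
    simp only [id, Pi.neg_apply]
    rw [neg_div', div_add_div _ _ ht.ne' hne]
    congr 1
    linear_combination (-(a * t * Real.exp (-(t * a)))) * e₁ + Real.exp (-t) * e₂
  have hcoef : ∀ t : ℝ, 0 < t → 0 ≤ Real.exp (-t) * Real.exp (-(t * a)) := fun t _ => by positivity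
  have hden : ∀ t : ℝ, 0 < t → 0 ≤ t * (1 - Real.exp (-(t * a))) := fun t ht =>
    (mul_pos ht (hpos t ht)).le
  change 0 ≤ f x
  rcases le_or_gt (a * x * Real.exp x - Real.exp (x * a) + 1) 0 with hneg | hpos'
  · have hanti : AntitoneOn f (Ici x) := by
      refine antitoneOn_of_deriv_nonpos (convex_Ici x)
        (fun t ht => (hderiv t (hx.trans_le ht)).continuousAt.continuousWithinAt) ?_ ?_ <;>
        rw [interior_Ici] <;> intro t ht
      · exact (hderiv t (hx.trans ht)).differentiableAt.differentiableWithinAt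
      · have ht0 : 0 < t := hx.trans ht
        rw [(hderiv t ht0).deriv]
        exact div_nonpos_of_nonpos_of_nonneg (mul_nonpos_of_nonneg_of_nonpos (hcoef t ht0)
          (mul_exp_sub_exp_nonpos_of_le ha hx (le_of_lt ht) hneg)) (hden t ht0)
    have hlim : Tendsto f atTop (𝓝 0) := by
      have hexp : Tendsto (fun t : ℝ => Real.exp (-(t * a))) atTop (𝓝 0) :=
        Real.tendsto_exp_neg_atTop_nhds_zero.comp (tendsto_id.atTop_mul_const ha)
      have h := tendsto_E1_atTop.add ((hexp.const_sub 1).log (by norm_num))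
      simpa using h
    refine le_of_tendsto hlim ?_
    filter_upwards [eventually_ge_atTop x] with t ht using hanti self_mem_Ici ht ht
  · have hmono : MonotoneOn f (Ioc 0 x) := by
      refine monotoneOn_of_deriv_nonneg (convex_Ioc 0 x)
        (fun t ht => (hderiv t ht.1).continuousAt.continuousWithinAt) ?_ ?_ <;>
        rw [interior_Ioc] <;> intro t ht
      · exact (hderiv t ht.1).differentiableAt.differentiableWithinAt
      · rw [(hderiv t ht.1).deriv]
        refine div_nonneg (mul_nonneg (hcoef t ht.1) ?_) (hden t ht.1)
        by_contra! hlt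
        exact hpos'.not_ge (mul_exp_sub_exp_nonpos_of_le ha ht.1 ht.2.le hlt.le)
    have hlim : Tendsto f (𝓝[>] 0) (𝓝 0) := by
      have h := tendsto_E1_add_log.add ((tendsto_one_sub_exp_neg_mul_div a).log ha.ne')
      rw [ha_def, Real.log_exp, neg_add_cancel, ← ha_def] at h
      refine h.congr' ?_
      filter_upwards [self_mem_nhdsWithin] with t ht
      have ht : 0 < t := ht
      rw [Real.log_div (hpos t ht).ne' ht.ne', hf]
      ring
    refine le_of_tendsto hlim ?_
    filter_upwards [Ioc_mem_nhdsGT hx] with t ht using hmono ht ⟨hx, le_rfl⟩ ht.2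

/-- For every `λ > 0`, the lower bound `E₁(λ) ≥ -ln(1 - e^{-λ e^γ})` holds, and consequently
`δ_λ = exp(-λ e^λ E₁(λ)) ≤ (1 - e^{-λ e^γ})^{λ e^λ}`. -/
theorem deltaLam_le_rpow' (lam : ℝ) (hlam : 0 < lam) :
    -Real.log (1 - Real.exp (-(lam * Real.exp Real.eulerMascheroniConstant))) ≤ E1 lam ∧
    Real.exp (-(lam * Real.exp lam * E1 lam)) ≤
      (1 - Real.exp (-(lam * Real.exp Real.eulerMascheroniConstant)))
        ^ (lam * Real.exp lam) := by
  have h := E1_add_log_nonneg hlam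
  have hbase : 0 < 1 - Real.exp (-(lam * Real.exp Real.eulerMascheroniConstant)) := by
    rw [sub_pos, Real.exp_lt_one_iff]
    exact neg_lt_zero.2 (by positivity)
  refine ⟨by linarith, ?_⟩
  rw [Real.rpow_def_of_pos hbase, Real.exp_le_exp]
  nlinarith [mul_pos hlam (Real.exp_pos lam)]
end
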